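/- The sequence Q_n = Σ_{k1=0}^{n} Σ_{k2=0}^{n} C(n+k1,n)·C(n,k1)²·C(n+k2,n)·C(n,k2)²·C(n+k1+k2,n) satisfies, for all n ≥ 2, the third-order recurrence 2(2n+1)(41218n³−48459n²+20010n−2871)(n+1)⁵ Q_{n+1} − (97604224n⁹ + 178061760n⁸ + 72005308n⁷ − 48634688n⁶ − 39076836n⁵ + 2622730n⁴ + 7581006n³ + 920112n² − 543402n − 120582) Q_n − 2n(3874492n⁸ − 2617900n⁷ − 3144314n⁶ + 2947148n⁵ + 647130n⁴ − 1182926n³ + 115771n² + 170716n − 44541) Q_{n−1} + n(41218n³ + 75195n² + 46746n + 9898)(n−1)⁵ Q_{n−2} = 0. -/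

import Mathlib

/-- The double binomial sum `Q n` (as an integer). -/
def cellQ (n : ℕ) : ℤ :=
  ∑ k1 ∈ Finset.range (n + 1), ∑ k2 ∈ Finset.range (n + 1),
    (Nat.choose (n + k1) n * (Nat.choose n k1)^2 *
     (Nat.choose (n + k2) n * (Nat.choose n k2)^2) *
     Nat.choose (n + k1 + k2) n : ℤ)


namespace CellQ

/-! Coefficients of the certificate polynomial. -/

def a00 (n : ℚ) : ℚ := -52573559*n^17 - 172243895/2*n^16 + 145735349/2*n^15 + 193911493*n^14 - 19283677*n^13 
        - 842716553/2*n^12 - 1744906893/2*n^11 - 1412770096*n^10 - 2052829792*n^9 - 6113744781/2*n^8 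
        - 11128833297/2*n^7 - 12178401711*n^6 - 27559728697*n^5 - 118831895167/2*n^4 + 168825021105/2*n^3 
        + 176518185130*n^2 - 48364092407*n^1 - 100140624618
def a01 (n : ℚ) : ℚ := -126394997*n^16 - 551232265/2*n^15 + 352981735/2*n^14 + 718850915/2*n^13 - 3395028347/2*n^12 
        - 13895169875/2*n^11 - 17329706624*n^10 - 33135511095*n^9 - 37426221195*n^8 + 66987957507/2*n^7 
        + 651604746493/2*n^6 + 2075479904405/2*n^5 + 4143691898287/2*n^4 - 4542022906847/2*n^3 
        - 5407103732558*n^2 + 1239776809175*n^1 + 3065858756290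
def a02 (n : ℚ) : ℚ := 129692437*n^15 - 472173913/2*n^14 - 823796460*n^13 - 2008325048*n^12 - 20506169955/2*n^11 
        - 71043220247/2*n^10 - 191048686103/2*n^9 - 238556311823*n^8 - 634330510426*n^7 - 4105548269583/2*n^6 
        - 8093027293355*n^5 - 34623616270122*n^4 + 44829994028789/2*n^3 + 175723246663407/2*n^2 
        - 27686540041139/2*n^1 - 51441229534215
def a03 (n : ℚ) : ℚ := 232201603*n^14 + 291438553/2*n^13 - 2239284145*n^12 - 14063503105/2*n^11 - 43256020311/2*n^10 
        - 146244161131/2*n^9 - 240236994521*n^8 - 817648970568*n^7 - 2997723860722*n^6 - 23386418490043/2*n^5 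
        - 47103405171091*n^4 - 33553032307311/2*n^3 - 144085651140931/2*n^2 + 66960211197549/2*n^1 
        + 134164505428649
def a04 (n : ℚ) : ℚ := -173692652*n^13 + 21775358*n^12 - 637709995*n^11 - 3634666509/2*n^10 - 1752613798*n^9 
        - 6390179394*n^8 - 101148011029/2*n^7 - 297270577531*n^6 - 2872805590977/2*n^5 - 6185841067254*n^4 
        - 50084583746775/2*n^3 - 197554315827407/2*n^2 - 60392104005825/2*n^1 - 125868194781341
def a05 (n : ℚ) : ℚ := -5275904*n^12 + 779802785*n^11 + 7130071391/2*n^10 + 12040167277*n^9 + 38279295945*n^8 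
        + 238228347397/2*n^7 + 387279141146*n^6 + 2760248929913/2*n^5 + 5341749581013*n^4 
        + 43180819911039/2*n^3 + 176377891399787/2*n^2 + 18735607415879/2*n^1 + 40179200755235
def a10 (n : ℚ) : ℚ := -198605320846*n^3 - 198605320846*n^2 + 198605320846*n^1 + 198605320846
def a11 (n : ℚ) : ℚ := -158338947*n^15 - 499367767/2*n^14 + 455586079/2*n^13 + 2449375489/2*n^12 + 9224396291/2*n^11 
        + 30107451467/2*n^10 + 64292525381/2*n^9 + 61425269111/2*n^8 - 159334346437/2*n^7 
        - 507188491072*n^6 - 1541977106204*n^5 - 3099126573294*n^4 + 7141874791754*n^3 + 11685527921266*n^2 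
        - 5954269068952*n^1 - 8523164862742
def a12 (n : ℚ) : ℚ := 86908153*n^14 - 842942077/2*n^13 + 196670022*n^12 + 15900074219/2*n^11 + 36576229868*n^10 
        + 273110959835/2*n^9 + 482887143012*n^8 + 3418944491987/2*n^7 + 6324048604999*n^6 
        + 24611194896767*n^5 + 98839707617742*n^4 - 114946955283353*n^3 - 293674767055400*n^2 
        + 96622456389026*n^1 + 196528726817718
def a13 (n : ℚ) : ℚ := 213797766*n^13 + 1332403599*n^12 + 4913278552*n^11 + 23417182161*n^10 + 205971865025/2*n^9 
        + 404720169602*n^8 + 3111627476343/2*n^7 + 12081479851971/2*n^6 + 23793910487076*n^5 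
        + 94781822465528*n^4 + 64665988711173/2*n^3 + 605694205879175/2*n^2 - 326719318956285/2*n^1 
        - 492226554205105
def a14 (n : ℚ) : ℚ := -4698852*n^12 + 1131517650*n^11 + 3334345481*n^10 + 15530497629/2*n^9 + 27872082948*n^8 
        + 121277356635*n^7 + 530763240363*n^6 + 4522005693441/2*n^5 + 9317195655295*n^4 + 37506151531257*n^3 
        + 149325189568209*n^2 + 60869148688967*n^1 + 430930603007076
def a15 (n : ℚ) : ℚ := -363563369*n^11 - 4471489613/2*n^10 - 21991120193/2*n^9 - 94743039871/2*n^8 - 186771615885*n^7 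
        - 711431788203*n^6 - 2727404851661*n^5 - 21324536342963/2*n^4 - 42381826598975*n^3 
        - 339921369977421/2*n^2 + 23344164481325/2*n^1 - 126808075453175
def a20 (n : ℚ) : ℚ := 202078343674*n^3 + 202078343674*n^2 - 202078343674*n^1 - 202078343674
def a21 (n : ℚ) : ℚ := -6977170325934*n^3 - 7179248669608*n^2 + 7381327013282*n^1 + 7583405356956
def a22 (n : ℚ) : ℚ := 22896599*n^13 + 57615523/2*n^12 - 2291712319/2*n^11 - 11289551336*n^10 - 67707723296*n^9 
        - 319369324268*n^8 - 1323966223383*n^7 - 5176287323318*n^6 - 19944161465560*n^5 - 154927391397467/2*n^4 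
        + 428193981526909/2*n^3 + 348727522268336*n^2 - 206916451387197*n^1 - 280317484861332
def a23 (n : ℚ) : ℚ := -108403340*n^12 - 1097448745*n^11 - 13086759769/2*n^10 - 38560673333*n^9 - 181512265181*n^8 
        - 765658572112*n^7 - 3070548642603*n^6 - 24109128410573/2*n^5 - 47239779133570*n^4 
        - 13309280353750*n^3 - 790251849089489/2*n^2 + 674893368239125/2*n^1 + 663589095403663
def a24 (n : ℚ) : ℚ := -152032593*n^11 - 1910703279/2*n^10 - 3369379264*n^9 - 23035912061/2*n^8 - 71584351325/2*n^7 
        - 205037683491/2*n^6 - 321903918905*n^5 - 2374897549841/2*n^4 - 9740788041705/2*n^3 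
        - 20553355014084*n^2 - 84509521380505*n^1 - 521013096918844
def a25 (n : ℚ) : ℚ := 192632323*n^10 + 4217300435/2*n^9 + 27186851507/2*n^8 + 139866172937/2*n^7 + 613817163449/2*n^6 
        + 1240589601704*n^5 + 9695141624001/2*n^4 + 37693235788323/2*n^3 + 147805180727623/2*n^2 
        - 106500121250579/2*n^1 + 130261694667003
def a30 (n : ℚ) : ℚ := -208903223282*n^3 - 208903223282*n^2 + 208903223282*n^1 + 208903223282
def a31 (n : ℚ) : ℚ := 1234041481000*n^3 + 1442944704282*n^2 - 1651847927564*n^1 - 1860751150846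
def a32 (n : ℚ) : ℚ := -173101042728838*n^3 - 174335084209838*n^2 + 175778028914120*n^1 + 177429876841684
def a33 (n : ℚ) : ℚ := 120851176*n^11 + 167444783*n^10 + 2711678097/2*n^9 + 8720426995/2*n^8 + 11834968891*n^7 
        + 71829527307/2*n^6 + 122323002355*n^5 + 935013818629/2*n^4 + 1908849041546*n^3 + 362022194409481/2*n^2 
        - 629907953622345/2*n^1 - 391614806057347
def a34 (n : ℚ) : ℚ := -89463669*n^10 - 2425736671/2*n^9 - 5275362783*n^8 - 19223261763*n^7 - 70293745481*n^6 
        - 522555591023/2*n^5 - 1005775119104*n^4 - 3989835906891*n^3 - 16061011532939*n^2 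
        + 108255124834479*n^1 + 259360955679674
def a35 (n : ℚ) : ℚ := 158895390*n^9 + 1541110942*n^8 + 16219961223/2*n^7 + 71007744771/2*n^6 + 282978000069/2*n^5 
        + 544208301217*n^4 + 4188281678643/2*n^3 + 16356264157237/2*n^2 + 64834561620961/2*n^1 
        - 43420564889001
def a40 (n : ℚ) : ℚ := 49935607*n^13 + 583207407/2*n^12 + 1597960755/2*n^11 + 1434437344*n^10 + 2079528443*n^9 
        + 3057822799*n^8 + 5559933815*n^7 + 12177691662*n^6 + 27560039903*n^5 + 118832010007/2*n^4 
        + 242035379803/2*n^3 + 28912015324*n^2 - 157066108047*n^1 - 105289575836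
def a41 (n : ℚ) : ℚ := -215858666*n^12 - 1276830038*n^11 - 7661617001/2*n^10 - 14534348133/2*n^9 - 10826933725/2*n^8 
        + 47874413321/2*n^7 + 265322557865/2*n^6 + 787989230855/2*n^5 + 1579234673993/2*n^4 
        + 1618706560043/2*n^3 - 236609981334*n^2 - 807880697097*n^1 - 265348099658
def a42 (n : ℚ) : ℚ := 298253448*n^11 + 2115361789*n^10 + 21152133905/2*n^9 + 94905718953/2*n^8 + 199510529115*n^7 
        + 1617075552781/2*n^6 + 3226616546249*n^5 + 25663519343693/2*n^4 + 51107464532843*n^3 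
        + 61924880833933/2*n^2 - 103488633919603/2*n^1 - 41992783135011
def a43 (n : ℚ) : ℚ := 23865222*n^10 - 60310846*n^9 - 2213171723/2*n^8 - 10057201168*n^7 - 58713004281*n^6 
        - 271956444922*n^5 - 2241720073351/2*n^4 - 4386048833000*n^3 - 16950907533270*n^2 
        + 107081336328930*n^1 + 85678696123670
def a44 (n : ℚ) : ℚ := -150837271*n^9 - 3729414109/2*n^8 - 11516309233*n^7 - 110234880911/2*n^6 - 464231245195/2*n^5 
        - 1835633002673/2*n^4 - 3556162794194*n^3 - 27656871494365/2*n^2 - 108847698182493/2*n^1 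
        - 43420564889001
def a45 (n : ℚ) : ℚ := -20609*n^8 + 89677/2*n^7 + 3363*n^6 - 54606*n^5 + 9339*n^4 + 52401/2*n^3 - 3577*n^2 
        - 4949*n^1

/-- Certificate polynomial. -/
def cert (n k l : ℚ) : ℚ :=
    a00 n * k^0 * l^0 + a01 n * k^0 * l^1 + a02 n * k^0 * l^2
    + a03 n * k^0 * l^3 + a04 n * k^0 * l^4 + a05 n * k^0 * l^5
    + a10 n * k^1 * l^0 + a11 n * k^1 * l^1 + a12 n * k^1 * l^2
    + a13 n * k^1 * l^3 + a14 n * k^1 * l^4 + a15 n * k^1 * l^5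
    + a20 n * k^2 * l^0 + a21 n * k^2 * l^1 + a22 n * k^2 * l^2
    + a23 n * k^2 * l^3 + a24 n * k^2 * l^4 + a25 n * k^2 * l^5
    + a30 n * k^3 * l^0 + a31 n * k^3 * l^1 + a32 n * k^3 * l^2
    + a33 n * k^3 * l^3 + a34 n * k^3 * l^4 + a35 n * k^3 * l^5
    + a40 n * k^4 * l^0 + a41 n * k^4 * l^1 + a42 n * k^4 * l^2
    + a43 n * k^4 * l^3 + a44 n * k^4 * l^4 + a45 n * k^4 * l^5

def polyA3 (n : ℚ) : ℚ := 2*(2*n + 1)*(41218*n^3 - 48459*n^2 + 20010*n - 2871)*(n + 1)^5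
def polyA2 (n : ℚ) : ℚ := 97604224*n^9 + 178061760*n^8 + 72005308*n^7 - 48634688*n^6
        - 39076836*n^5 + 2622730*n^4 + 7581006*n^3 + 920112*n^2
        - 543402*n - 120582
def polyA1 (n : ℚ) : ℚ := 2*n*(3874492*n^8 - 2617900*n^7 - 3144314*n^6 + 2947148*n^5
        + 647130*n^4 - 1182926*n^3 + 115771*n^2 + 170716*n - 44541)
def polyA0 (n : ℚ) : ℚ := n*(41218*n^3 + 75195*n^2 + 46746*n + 9898)*(n - 1)^5

/-- ratios of the shifted summands to the common term -/
def r3 (n k l : ℚ) : ℚ := ((n-1)*n*(n+1)) * ((n-1+k)*(n+k)*(n+1+k)) * ((n-1+l)*(n+l)*(n+1+l))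
  * ((n-1+k+l)*(n+k+l)*(n+1+k+l))
def r2 (n k l : ℚ) : ℚ := ((n-1)*n) * ((n-1+k)*(n+k)) * ((n-1+l)*(n+l))
  * ((n-1+k+l)*(n+k+l)) * (n+1-k)^2 * (n+1-l)^2
def r1 (n k l : ℚ) : ℚ := (n-1) * (n-1+k) * (n-1+l)
  * (n-1+k+l) * ((n+1-k)*(n-k))^2 * ((n+1-l)*(n-l))^2
def r0 (n k l : ℚ) : ℚ := ((n+1-k)*(n-k)*(n-1-k))^2 * ((n+1-l)*(n-l)*(n-1-l))^2

def delta (n k l : ℚ) : ℚ :=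
  (n-1+k)*(n-1+k+l)*(n+1-k)^2 * cert n (k+1) l - k^3*(k+l) * cert n k l

set_option maxHeartbeats 0 in
set_option maxRecDepth 100000 in
theorem cert_identity (n k l : ℚ) :
    polyA3 n * r3 n k l - polyA2 n * r2 n k l - polyA1 n * r1 n k l + polyA0 n * r0 n k l
      = delta n k l + delta n l k := by
  simp only [polyA3, polyA2, polyA1, polyA0, r3, r2, r1, r0, delta, cert,
    a00, a01, a02, a03, a04, a05, a10, a11, a12, a13, a14, a15,
    a20, a21, a22, a23, a24, a25, a30, a31, a32, a33, a34, a35,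
    a40, a41, a42, a43, a44, a45]
  ring
/-- The summand of `cellQ`, as a rational number. -/

def F (N k l : ℕ) : ℚ :=
  (Nat.choose (N + k) N * (Nat.choose N k)^2 *
     (Nat.choose (N + l) N * (Nat.choose N l)^2) *
     Nat.choose (N + k + l) N : ℚ)
/-- The common hypergeometric term. -/

def T (m k l : ℕ) : ℚ :=
  ((m+k).factorial * (m+l).factorial * (m+k+l).factorial : ℚ)
    * (Nat.choose (m+3) k : ℚ)^2 * (Nat.choose (m+3) l : ℚ)^2
    / (k.factorial * l.factorial * (k+l).factorial * (m.factorial : ℚ)^3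
        * (((m:ℚ)+1)*(m+2)*(m+3))^4)

theorem choose_up (N k : ℕ) :
    (Nat.choose N k : ℚ) = (Nat.choose (N+1) k : ℚ) * ((N:ℚ) + 1 - k) / ((N:ℚ) + 1) := by
  have h := Nat.choose_mul_succ_eq N k
  have hN : (N:ℚ) + 1 ≠ 0 := by positivity
  rw [eq_div_iff hN]
  rcases le_or_gt k (N+1) with hk | hk
  · have h' : ((Nat.choose N k * (N+1) : ℕ) : ℚ) = ((Nat.choose (N+1) k * (N+1-k) : ℕ) : ℚ) := by
      rw [h]
    push_cast [Nat.cast_sub hk] at h'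
    exact h'
  · rw [Nat.choose_eq_zero_of_lt hk, Nat.choose_eq_zero_of_lt (by omega : N < k)]
    simp

theorem choose_right (N k : ℕ) :
    (Nat.choose N (k+1) : ℚ) = (Nat.choose N k : ℚ) * ((N:ℚ) - k) / ((k:ℚ) + 1) := by
  have h := Nat.choose_succ_right_eq N k
  have hN : (k:ℚ) + 1 ≠ 0 := by positivity
  rw [eq_div_iff hN]
  rcases le_or_gt k N with hk | hk
  · have h' : ((Nat.choose N (k+1) * (k+1) : ℕ) : ℚ) = ((Nat.choose N k * (N-k) : ℕ) : ℚ) := by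
      rw [h]
    push_cast [Nat.cast_sub hk] at h'
    exact h'
  · rw [Nat.choose_eq_zero_of_lt hk, Nat.choose_eq_zero_of_lt (by omega : N < k+1)]
    simp

theorem choose_fact (N k : ℕ) :
    (Nat.choose (N+k) N : ℚ) = ((N+k).factorial : ℚ) / (N.factorial * k.factorial) := by
  rw [Nat.cast_choose ℚ (Nat.le_add_right N k), Nat.add_sub_cancel_left]

theorem F_eq (N k l : ℕ) : F N k l =
    ((N+k).factorial * (N+l).factorial * (N+k+l).factorial : ℚ)
    * (Nat.choose N k : ℚ)^2 * (Nat.choose N l : ℚ)^2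
    / (k.factorial * l.factorial * (k+l).factorial * (N.factorial : ℚ)^3) := by
  unfold F
  rw [add_assoc N k l, choose_fact, choose_fact, choose_fact]
  have h1 : (N.factorial : ℚ) ≠ 0 := by positivity
  have h2 : (k.factorial : ℚ) ≠ 0 := by positivity
  have h3 : (l.factorial : ℚ) ≠ 0 := by positivity
  have h4 : ((k+l).factorial : ℚ) ≠ 0 := by positivity
  field_simp

theorem fact_s (N : ℕ) : ((N+1).factorial : ℚ) = ((N:ℚ)+1) * N.factorial := by
  rw [Nat.factorial_succ]; push_cast; ring

theorem c2 (m k : ℕ) : (Nat.choose (m+2) k : ℚ)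
    = (Nat.choose (m+3) k : ℚ) * ((m:ℚ) + 3 - k) / ((m:ℚ) + 3) := by
  rw [choose_up (m+2) k]; push_cast; ring_nf

theorem c1 (m k : ℕ) : (Nat.choose (m+1) k : ℚ)
    = (Nat.choose (m+3) k : ℚ) * (((m:ℚ) + 3 - k) * ((m:ℚ) + 2 - k))
      / (((m:ℚ) + 3) * ((m:ℚ)+2)) := by
  rw [choose_up (m+1) k, c2]; push_cast; 
  have h2 : (m:ℚ) + 2 ≠ 0 := by positivity
  have h3 : (m:ℚ) + 3 ≠ 0 := by positivity
  have h2' : (m:ℚ) + 1 + 1 ≠ 0 := by positivity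
  field_simp
  ring

theorem c0 (m k : ℕ) : (Nat.choose m k : ℚ)
    = (Nat.choose (m+3) k : ℚ) * (((m:ℚ) + 3 - k) * ((m:ℚ) + 2 - k) * ((m:ℚ) + 1 - k))
      / (((m:ℚ) + 3) * ((m:ℚ)+2) * ((m:ℚ)+1)) := by
  rw [choose_up m k, c1]
  have h1 : (m:ℚ) + 1 ≠ 0 := by positivity
  have h2 : (m:ℚ) + 2 ≠ 0 := by positivity
  have h3 : (m:ℚ) + 3 ≠ 0 := by positivity
  field_simp

theorem f1 (m x : ℕ) : ((m+1+x).factorial : ℚ) = ((m:ℚ)+1+x) * (m+x).factorial := by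
  rw [show m+1+x = (m+x)+1 by ring, fact_s]; push_cast; ring

theorem f2 (m x : ℕ) : ((m+2+x).factorial : ℚ)
    = ((m:ℚ)+2+x) * (((m:ℚ)+1+x) * (m+x).factorial) := by
  rw [show m+2+x = (m+1)+1+x by ring, f1, f1]; push_cast; ring

theorem f3 (m x : ℕ) : ((m+3+x).factorial : ℚ)
    = ((m:ℚ)+3+x) * (((m:ℚ)+2+x) * (((m:ℚ)+1+x) * (m+x).factorial)) := by
  rw [show m+3+x = (m+2)+1+x by ring, f1, f2]; push_cast; ring

theorem abs3 (a b c x1 x2 x3 y1 y2 y3 z1 z2 z3 X Y Z C D K L M W : ℚ)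
    (ha : a ≠ 0) (hb : b ≠ 0) (hc : c ≠ 0)
    (hK : K ≠ 0) (hL : L ≠ 0) (hM : M ≠ 0) (hW : W ≠ 0) :
    (x3*(x2*(x1*X))) * (y3*(y2*(y1*Y))) * (z3*(z2*(z1*Z))) * C^2 * D^2
      / (K*L*M*(c*(b*(a*W)))^3)
    = ((a*b*c)*(x1*x2*x3)*(y1*y2*y3)*(z1*z2*z3))
      * (X*Y*Z*C^2*D^2/(K*L*M*W^3*(a*b*c)^4)) := by
  simp only [div_pow, mul_div_assoc', div_mul_eq_mul_div, div_div]
  rw [div_eq_div_iff (by positivity) (by positivity)]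
  ring

theorem abs2 (a b c p q x1 x2 y1 y2 z1 z2 X Y Z C D K L M W : ℚ)
    (ha : a ≠ 0) (hb : b ≠ 0) (hc : c ≠ 0)
    (hK : K ≠ 0) (hL : L ≠ 0) (hM : M ≠ 0) (hW : W ≠ 0) :
    (x2*(x1*X)) * (y2*(y1*Y)) * (z2*(z1*Z)) * (C*p/c)^2 * (D*q/c)^2
      / (K*L*M*(b*(a*W))^3)
    = ((a*b)*(x1*x2)*(y1*y2)*(z1*z2)*p^2*q^2)
      * (X*Y*Z*C^2*D^2/(K*L*M*W^3*(a*b*c)^4)) := by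
  simp only [div_pow, mul_div_assoc', div_mul_eq_mul_div, div_div]
  rw [div_eq_div_iff (by positivity) (by positivity)]
  ring

theorem abs1 (a b c p q p' q' x1 y1 z1 X Y Z C D K L M W : ℚ)
    (ha : a ≠ 0) (hb : b ≠ 0) (hc : c ≠ 0)
    (hK : K ≠ 0) (hL : L ≠ 0) (hM : M ≠ 0) (hW : W ≠ 0) :
    (x1*X) * (y1*Y) * (z1*Z) * (C*(p*p')/(c*b))^2 * (D*(q*q')/(c*b))^2
      / (K*L*M*(a*W)^3)
    = (a*x1*y1*z1*(p*p')^2*(q*q')^2)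
      * (X*Y*Z*C^2*D^2/(K*L*M*W^3*(a*b*c)^4)) := by
  simp only [div_pow, mul_div_assoc', div_mul_eq_mul_div, div_div]
  rw [div_eq_div_iff (by positivity) (by positivity)]
  ring

theorem abs0 (a b c p q X Y Z C D K L M W : ℚ)
    (ha : a ≠ 0) (hb : b ≠ 0) (hc : c ≠ 0)
    (hK : K ≠ 0) (hL : L ≠ 0) (hM : M ≠ 0) (hW : W ≠ 0) :
    X * Y * Z * (C*p/(c*b*a))^2 * (D*q/(c*b*a))^2 / (K*L*M*W^3)
    = (p^2*q^2) * (X*Y*Z*C^2*D^2/(K*L*M*W^3*(a*b*c)^4)) := by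
  simp only [div_pow, mul_div_assoc', div_mul_eq_mul_div, div_div]
  rw [div_eq_div_iff (by positivity) (by positivity)]
  ring

theorem F3 (m k l : ℕ) : F (m+3) k l = r3 ((m:ℚ)+2) k l * T m k l := by
  have h1 : (m:ℚ) + 1 ≠ 0 := by positivity
  have h2 : (m:ℚ) + 2 ≠ 0 := by positivity
  have h3 : (m:ℚ) + 3 ≠ 0 := by positivity
  have e := f3 m 0
  simp only [add_zero, Nat.cast_zero] at e
  rw [F_eq, T, r3, add_assoc (m+3) k l, add_assoc m k l, f3, f3, f3, e, abs3 _ _ _ _ _ _ _ _ _ _ _ _ _ _ _ _ _ _ _ _ _ h1 h2 h3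
    (by positivity) (by positivity) (by positivity) (by positivity)]
  congr 1
  push_cast
  ring

theorem F2 (m k l : ℕ) : F (m+2) k l = r2 ((m:ℚ)+2) k l * T m k l := by
  have h1 : (m:ℚ) + 1 ≠ 0 := by positivity
  have h2 : (m:ℚ) + 2 ≠ 0 := by positivity
  have h3 : (m:ℚ) + 3 ≠ 0 := by positivity
  have e := f2 m 0
  simp only [add_zero, Nat.cast_zero] at e
  rw [F_eq, T, r2, add_assoc (m+2) k l, add_assoc m k l, f2, f2, f2, e, c2 m k, c2 m l, abs2 _ _ _ _ _ _ _ _ _ _ _ _ _ _ _ _ _ _ _ _ h1 h2 h3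
    (by positivity) (by positivity) (by positivity) (by positivity)]
  congr 1
  push_cast
  ring

theorem F1 (m k l : ℕ) : F (m+1) k l = r1 ((m:ℚ)+2) k l * T m k l := by
  have h1 : (m:ℚ) + 1 ≠ 0 := by positivity
  have h2 : (m:ℚ) + 2 ≠ 0 := by positivity
  have h3 : (m:ℚ) + 3 ≠ 0 := by positivity
  have e := f1 m 0
  simp only [add_zero, Nat.cast_zero] at e
  rw [F_eq, T, r1, add_assoc (m+1) k l, add_assoc m k l, f1, f1, f1, e, c1 m k, c1 m l, abs1 _ _ _ _ _ _ _ _ _ _ _ _ _ _ _ _ _ _ _ h1 h2 h3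
    (by positivity) (by positivity) (by positivity) (by positivity)]
  congr 1
  push_cast
  ring

theorem F0 (m k l : ℕ) : F (m) k l = r0 ((m:ℚ)+2) k l * T m k l := by
  have h1 : (m:ℚ) + 1 ≠ 0 := by positivity
  have h2 : (m:ℚ) + 2 ≠ 0 := by positivity
  have h3 : (m:ℚ) + 3 ≠ 0 := by positivity
  rw [F_eq, T, r0, c0 m k, c0 m l, abs0 _ _ _ _ _ _ _ _ _ _ _ _ _ _ h1 h2 h3
    (by positivity) (by positivity) (by positivity) (by positivity)]
  congr 1
  push_cast
  ring

theorem T_symm (m k l : ℕ) : T m k l = T m l k := by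
  unfold T
  rw [add_comm k l, show m + k + l = m + l + k by ring]
  ring

theorem T_succ (m k l : ℕ) : ((k:ℚ)+1)^3 * ((k:ℚ)+1+l) * T m (k+1) l
    = ((m:ℚ)+1+k) * ((m:ℚ)+1+k+l) * ((m:ℚ)+3-k)^2 * T m k l := by
  unfold T
  rw [choose_right, show m + (k+1) + l = m+1+(k+l) by ring, show m + (k+1) = m+1+k by ring,
    show k+1+l = (k+l)+1 by ring, f1, f1, fact_s, fact_s, add_assoc m k l]
  have h1 : (m:ℚ) + 1 ≠ 0 := by positivity
  have h2 : (m:ℚ) + 2 ≠ 0 := by positivity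
  have h3 : (m:ℚ) + 3 ≠ 0 := by positivity
  have h4 : (m.factorial : ℚ) ≠ 0 := by positivity
  have h5 : (k.factorial : ℚ) ≠ 0 := by positivity
  have h6 : (l.factorial : ℚ) ≠ 0 := by positivity
  have h7 : ((k+l).factorial : ℚ) ≠ 0 := by positivity
  have h8 : (k:ℚ) + 1 ≠ 0 := by positivity
  have h9 : (k:ℚ) + l + 1 ≠ 0 := by positivity
  push_cast
  field_simp
  ring

def G (m l k : ℕ) : ℚ := (k:ℚ)^3 * ((k:ℚ)+l) * cert ((m:ℚ)+2) k l * T m k l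

theorem delta_T (m k l : ℕ) :
    delta ((m:ℚ)+2) k l * T m k l = G m l (k+1) - G m l k := by
  have h := T_succ m k l
  unfold G delta
  push_cast
  linear_combination (-cert ((m:ℚ)+2) (k+1) l) * h

theorem sum_delta (m l : ℕ) :
    ∑ k ∈ Finset.range (m+4), delta ((m:ℚ)+2) k l * T m k l = 0 := by
  simp only [delta_T]
  rw [Finset.sum_range_sub]
  simp [G, T]

theorem cellQ_ext (N M : ℕ) (h : N + 1 ≤ M) : (cellQ N : ℚ)
    = ∑ k ∈ Finset.range M, ∑ l ∈ Finset.range M, F N k l := by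
  have e : (cellQ N : ℚ)
      = ∑ k ∈ Finset.range (N+1), ∑ l ∈ Finset.range (N+1), F N k l := by
    unfold cellQ F
    push_cast
    rfl
  have hs : Finset.range (N+1) ⊆ Finset.range M := by
    intro x hx
    rw [Finset.mem_range] at *
    omega
  rw [e]
  have e2 : ∀ k, ∑ l ∈ Finset.range (N+1), F N k l = ∑ l ∈ Finset.range M, F N k l := by
    intro k
    apply Finset.sum_subset hs
    intro x _ hx
    rw [Finset.mem_range] at hx
    simp [F, Nat.choose_eq_zero_of_lt (by omega : N < x)]
  simp only [e2]
  apply Finset.sum_subset hs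
  intro x _ hx
  rw [Finset.mem_range] at hx
  simp [F, Nat.choose_eq_zero_of_lt (by omega : N < x)]

theorem main (m : ℕ) :
    polyA3 ((m:ℚ)+2) * cellQ (m+3) - polyA2 ((m:ℚ)+2) * cellQ (m+2)
      - polyA1 ((m:ℚ)+2) * cellQ (m+1) + polyA0 ((m:ℚ)+2) * cellQ m = 0 := by
  rw [cellQ_ext (m+3) (m+4) (by omega), cellQ_ext (m+2) (m+4) (by omega),
    cellQ_ext (m+1) (m+4) (by omega), cellQ_ext m (m+4) (by omega)]
  simp only [Finset.mul_sum, ← Finset.sum_sub_distrib, ← Finset.sum_add_distrib]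
  have key : ∀ k l : ℕ, polyA3 ((m:ℚ)+2) * F (m+3) k l - polyA2 ((m:ℚ)+2) * F (m+2) k l
      - polyA1 ((m:ℚ)+2) * F (m+1) k l + polyA0 ((m:ℚ)+2) * F m k l
      = delta ((m:ℚ)+2) k l * T m k l + delta ((m:ℚ)+2) l k * T m l k := by
    intro k l
    rw [F3, F2, F1, F0, T_symm m l k]
    linear_combination T m k l * cert_identity ((m:ℚ)+2) k l
  simp only [key, Finset.sum_add_distrib]
  rw [Finset.sum_comm]
  simp [sum_delta]
end CellQ

theorem cellQ_recurrence (n : ℕ) (hn : 2 ≤ n) :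
    2*(2*(n:ℤ) + 1)*(41218*(n:ℤ)^3 - 48459*(n:ℤ)^2 + 20010*(n:ℤ) - 2871)*((n:ℤ) + 1)^5
        * cellQ (n + 1)
    - (97604224*(n:ℤ)^9 + 178061760*(n:ℤ)^8 + 72005308*(n:ℤ)^7 - 48634688*(n:ℤ)^6
        - 39076836*(n:ℤ)^5 + 2622730*(n:ℤ)^4 + 7581006*(n:ℤ)^3 + 920112*(n:ℤ)^2
        - 543402*(n:ℤ) - 120582) * cellQ n
    - 2*(n:ℤ)*(3874492*(n:ℤ)^8 - 2617900*(n:ℤ)^7 - 3144314*(n:ℤ)^6 + 2947148*(n:ℤ)^5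
        + 647130*(n:ℤ)^4 - 1182926*(n:ℤ)^3 + 115771*(n:ℤ)^2 + 170716*(n:ℤ) - 44541)
        * cellQ (n - 1)
    + (n:ℤ)*(41218*(n:ℤ)^3 + 75195*(n:ℤ)^2 + 46746*(n:ℤ) + 9898)*((n:ℤ) - 1)^5
        * cellQ (n - 2) = 0 := by
  obtain ⟨m, hm⟩ : ∃ m, n = m + 2 := ⟨n - 2, by omega⟩
  have h := CellQ.main m
  have hq : (m:ℚ) + 2 = (n:ℚ) := by rw [hm]; push_cast; ring
  have e0 : n - 2 = m := by omega
  have e1 : n - 1 = m + 1 := by omega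
  have e2 : m + 2 = n := hm.symm
  have e3 : n + 1 = m + 3 := by omega
  rw [hq, e2] at h
  rw [e0, e1, e3]
  clear hn hm hq e0 e1 e2 e3
  unfold CellQ.polyA3 CellQ.polyA2 CellQ.polyA1 CellQ.polyA0 at h
  generalize cellQ (m + 3) = q3 at *
  generalize cellQ n = q2 at *
  generalize cellQ (m + 1) = q1 at *
  generalize cellQ m = q0 at *
  apply Int.cast_injective (α := ℚ)
  push_cast
  linear_combination h
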